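/- Let Y_1 and Y_2 be independent mean-zero Gaussian random vectors in R^p with common covariance matrix Ω. Then E[(Y_1^T Y_2)^4] = 6 tr(Ω^4) + 3 [tr(Ω^2)]^2. -/

import Mathlib

open MeasureTheory ProbabilityTheory Matrix
open scoped BigOperators NNReal

def IsCenteredGaussianVec {p : ℕ} (μ : Measure (Fin p → ℝ)) : Prop :=
  ∀ l : (Fin p → ℝ) →L[ℝ] ℝ, ∃ v : ℝ≥0, μ.map l = gaussianReal 0 v

/-- Differentiating a polynomial times `exp (v t² / 2)`, the moment generating function of a
centered real Gaussian. -/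
lemma hasDerivAt_mul_exp_sq {f : ℝ → ℝ} {f' t : ℝ} (v : ℝ) (hf : HasDerivAt f f' t) :
    HasDerivAt (fun t ↦ f t * Real.exp (v * t ^ 2 / 2))
      ((f' + v * t * f t) * Real.exp (v * t ^ 2 / 2)) t := by
  have h : HasDerivAt (fun t : ℝ ↦ v * t ^ 2 / 2) (v * t) t := by
    refine (((hasDerivAt_pow 2 t).const_mul v).div_const 2).congr_deriv ?_
    push_cast
    ring
  refine (hf.fun_mul h.exp).congr_deriv ?_
  ring

lemma integral_pow_two_gaussianReal (v : ℝ≥0) : ∫ x, x ^ 2 ∂(gaussianReal 0 v) = v := by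
  have h := variance_fun_id_gaussianReal (μ := 0) (v := v)
  rw [variance_eq_integral measurable_id'.aemeasurable] at h
  simpa using h

lemma integral_pow_four_gaussianReal (v : ℝ≥0) :
    ∫ x, x ^ 4 ∂(gaussianReal 0 v) = 3 * (v : ℝ) ^ 2 := by
  have h0 : mgf (fun x ↦ x) (gaussianReal 0 v) = fun t ↦ 1 * Real.exp (v * t ^ 2 / 2) := by
    simp [mgf_fun_id_gaussianReal]
  have h1 : deriv (fun t : ℝ ↦ 1 * Real.exp (v * t ^ 2 / 2)) =
      fun t ↦ (v * t) * Real.exp (v * t ^ 2 / 2) := by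
    ext t
    rw [(hasDerivAt_mul_exp_sq v (hasDerivAt_const t 1)).deriv]
    ring
  have h2 : deriv (fun t : ℝ ↦ (v * t) * Real.exp (v * t ^ 2 / 2)) =
      fun t ↦ (v + v ^ 2 * t ^ 2) * Real.exp (v * t ^ 2 / 2) := by
    ext t
    rw [(hasDerivAt_mul_exp_sq v ((hasDerivAt_id' t).const_mul (v : ℝ))).deriv]
    ring
  have h3 : deriv (fun t : ℝ ↦ (v + v ^ 2 * t ^ 2) * Real.exp (v * t ^ 2 / 2)) =
      fun t ↦ (3 * v ^ 2 * t + v ^ 3 * t ^ 3) * Real.exp (v * t ^ 2 / 2) := by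
    ext t
    rw [(hasDerivAt_mul_exp_sq v
      (((hasDerivAt_pow 2 t).const_mul ((v : ℝ) ^ 2)).const_add (v : ℝ))).deriv]
    push_cast
    ring
  have h4 : deriv (fun t : ℝ ↦ (3 * v ^ 2 * t + v ^ 3 * t ^ 3) * Real.exp (v * t ^ 2 / 2)) 0 =
      3 * (v : ℝ) ^ 2 := by
    rw [(hasDerivAt_mul_exp_sq v (((hasDerivAt_id' (0 : ℝ)).const_mul (3 * (v : ℝ) ^ 2)).fun_add
      ((hasDerivAt_pow 3 (0 : ℝ)).const_mul ((v : ℝ) ^ 3)))).deriv]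
    simp
  calc ∫ x, x ^ 4 ∂(gaussianReal 0 v)
    _ = iteratedDeriv 4 (mgf (fun x ↦ x) (gaussianReal 0 v)) 0 := by
      rw [iteratedDeriv_mgf_zero] <;> simp
    _ = 3 * (v : ℝ) ^ 2 := by
      rw [iteratedDeriv_succ, iteratedDeriv_succ, iteratedDeriv_succ, iteratedDeriv_one,
        h0, h1, h2, h3, h4]

namespace IsCenteredGaussianVec

variable {p : ℕ} {ν : Measure (Fin p → ℝ)}

lemma isGaussian (h : IsCenteredGaussianVec ν) : IsGaussian ν :=
  isGaussian_of_map_eq_gaussianReal fun l ↦ ⟨0, h l⟩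

lemma memLp_eval (h : IsCenteredGaussianVec ν) (a : Fin p) : MemLp (fun x ↦ x a) 4 ν :=
  have := h.isGaussian
  this.memLp_dual ν (ContinuousLinearMap.proj a) 4 (by simp)

lemma memLp_eval_mul_eval (h : IsCenteredGaussianVec ν) (a b : Fin p) :
    MemLp (fun x ↦ x a * x b) 2 ν := by
  have : ENNReal.HolderTriple 4 4 2 := ⟨by
    rw [← ENNReal.toReal_eq_toReal_iff' (by simp) (by simp),
      ENNReal.toReal_add (by simp) (by simp)]
    norm_num⟩
  exact (h.memLp_eval b).mul (h.memLp_eval a)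

lemma integrable_eval_mul_eval (h : IsCenteredGaussianVec ν) (a b : Fin p) :
    Integrable (fun x ↦ x a * x b) ν :=
  have := h.isGaussian
  (h.memLp_eval_mul_eval a b).integrable (by norm_num)

lemma integrable_eval_mul_four (h : IsCenteredGaussianVec ν) (a b c d : Fin p) :
    Integrable (fun x ↦ x a * x b * (x c * x d)) ν :=
  (h.memLp_eval_mul_eval a b).integrable_mul (h.memLp_eval_mul_eval c d)

lemma integral_dual_pow_four (h : IsCenteredGaussianVec ν) (l : (Fin p → ℝ) →L[ℝ] ℝ) :
    ∫ x, l x ^ 4 ∂ν = 3 * (∫ x, l x ^ 2 ∂ν) ^ 2 := by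
  obtain ⟨v, hv⟩ := h l
  have h4 : ∫ x, l x ^ 4 ∂ν = ∫ y, y ^ 4 ∂(ν.map l) := by
    rw [integral_map (by fun_prop) (by fun_prop)]
  have h2 : ∫ x, l x ^ 2 ∂ν = ∫ y, y ^ 2 ∂(ν.map l) := by
    rw [integral_map (by fun_prop) (by fun_prop)]
  rw [h4, h2, hv, integral_pow_four_gaussianReal, integral_pow_two_gaussianReal]

lemma integrable_dual_pow_four (h : IsCenteredGaussianVec ν) (l : (Fin p → ℝ) →L[ℝ] ℝ) :
    Integrable (fun x ↦ l x ^ 4) ν := by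
  have := h.isGaussian
  have := (this.memLp_dual ν l 4 (by simp)).integrable_norm_pow (p := 4) (by simp)
  simpa [Even.pow_abs (show Even 4 by decide)] using this

/-- **Isserlis' theorem** for four coordinates of a centered Gaussian vector. -/
theorem integral_eval_mul_four (h : IsCenteredGaussianVec ν) {S : Matrix (Fin p) (Fin p) ℝ}
    (hS : ∀ a b, ∫ x, x a * x b ∂ν = S a b) (a b c d : Fin p) :
    ∫ x, x a * x b * (x c * x d) ∂ν = S a b * S c d + S a c * S b d + S a d * S b c := by
  let l (s t u : ℝ) : (Fin p → ℝ) →L[ℝ] ℝ :=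
    .proj a + s • .proj b + t • .proj c + u • .proj d
  have hl (s t u : ℝ) (x : Fin p → ℝ) : l s t u x = x a + s * x b + t * x c + u * x d := rfl
  have hq (s t u : ℝ) : ∫ x, l s t u x ^ 2 ∂ν =
      S a a + s ^ 2 * S b b + t ^ 2 * S c c + u ^ 2 * S d d + 2 * s * S a b + 2 * t * S a c
        + 2 * u * S a d + 2 * s * t * S b c + 2 * s * u * S b d + 2 * t * u * S c d := by
    have hi := h.integrable_eval_mul_eval
    have e (x : Fin p → ℝ) : l s t u x ^ 2 = x a * x a + s ^ 2 * (x b * x b) +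
        t ^ 2 * (x c * x c) + u ^ 2 * (x d * x d) + 2 * s * (x a * x b) + 2 * t * (x a * x c)
        + 2 * u * (x a * x d) + 2 * s * t * (x b * x c) + 2 * s * u * (x b * x d)
        + 2 * t * u * (x c * x d) := by
      rw [hl]; ring
    simp_rw [e]
    repeat rw [integral_add (by fun_prop) (by fun_prop)]
    simp only [integral_const_mul, hS]
  have hp (s t u : ℝ) := (h.integral_dual_pow_four (l s t u)).trans (by rw [hq])
  have hi (s t u : ℝ) := h.integrable_dual_pow_four (l s t u)
  have e (x : Fin p → ℝ) : x a * x b * (x c * x d) =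
      (1 / 192) * (l 1 1 1 x ^ 4 + l 1 (-1) (-1) x ^ 4 + l (-1) 1 (-1) x ^ 4 + l (-1) (-1) 1 x ^ 4
        - l 1 1 (-1) x ^ 4 - l 1 (-1) 1 x ^ 4 - l (-1) 1 1 x ^ 4 - l (-1) (-1) (-1) x ^ 4) := by
    simp only [hl]; ring
  simp_rw [e]
  rw [integral_const_mul]
  repeat rw [integral_sub (by fun_prop) (by fun_prop)]
  repeat rw [integral_add (by fun_prop) (by fun_prop)]
  simp only [hp]
  ring

end IsCenteredGaussianVec

/-- The fourth power of a dot product, as a sum over quadruples of coordinates. -/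
lemma dotProduct_pow_four {n R : Type*} [Fintype n] [CommRing R] (u v : n → R) :
    (u ⬝ᵥ v) ^ 4 =
      ∑ a, ∑ b, ∑ c, ∑ d, (u a * u b * (u c * u d)) * (v a * v b * (v c * v d)) := by
  calc (u ⬝ᵥ v) ^ 4
    _ = ∑ a, ∑ b, ∑ c, ∑ d, (u a * v a) * ((u b * v b) * ((u c * v c) * (u d * v d))) := by
      simp_rw [← Finset.mul_sum, ← Finset.sum_mul, dotProduct]
      ring
    _ = _ := by
      refine Finset.sum_congr rfl fun a _ ↦ Finset.sum_congr rfl fun b _ ↦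
        Finset.sum_congr rfl fun c _ ↦ Finset.sum_congr rfl fun d _ ↦ ?_
      ring

lemma sum_isserlis_sq {n R : Type*} [Fintype n] [DecidableEq n] [CommRing R] {S : Matrix n n R}
    (hS : S.IsSymm) :
    ∑ a, ∑ b, ∑ c, ∑ d, (S a b * S c d + S a c * S b d + S a d * S b c) ^ 2 =
      6 * (S ^ 4).trace + 3 * (S ^ 2).trace ^ 2 := by
  have h2 : (S ^ 2).trace ^ 2 = ∑ a, ∑ b, ∑ c, ∑ d, S a b ^ 2 * S c d ^ 2 := by
    simp_rw [← Finset.mul_sum, ← Finset.sum_mul]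
    rw [sq (trace _)]
    simp_rw [sq, trace, diag_apply, mul_apply]
    simp_rw [fun a b ↦ hS.apply a b]
  have h4 : (S ^ 4).trace = ∑ a, ∑ b, ∑ c, ∑ d, S a b * S b c * S c d * S a d := by
    have : S ^ 4 = S * (S * (S * S)) := by noncomm_ring
    simp_rw [this, trace, diag_apply, mul_apply, Finset.mul_sum]
    refine Finset.sum_congr rfl fun a _ ↦ Finset.sum_congr rfl fun b _ ↦
      Finset.sum_congr rfl fun c _ ↦ Finset.sum_congr rfl fun d _ ↦ ?_
    rw [hS.apply a d]
    ring
  have h2' : ∑ a, ∑ b, ∑ c, ∑ d, S a c ^ 2 * S b d ^ 2 = (S ^ 2).trace ^ 2 :=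
    h2 ▸ Finset.sum_congr rfl fun a _ ↦ Finset.sum_comm
  have h2'' : ∑ a, ∑ b, ∑ c, ∑ d, S a d ^ 2 * S b c ^ 2 = (S ^ 2).trace ^ 2 :=
    h2' ▸ Finset.sum_congr rfl fun a _ ↦ Finset.sum_congr rfl fun b _ ↦ Finset.sum_comm
  have h4' : ∑ a, ∑ b, ∑ c, ∑ d, S a b * S b d * S c d * S a c = (S ^ 4).trace := by
    rw [h4]
    refine Finset.sum_congr rfl fun a _ ↦ Finset.sum_congr rfl fun b _ ↦ ?_
    rw [Finset.sum_comm]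
    simp_rw [fun c d ↦ hS.apply c d]
  have h4'' : ∑ a, ∑ b, ∑ c, ∑ d, S a c * S b c * S b d * S a d = (S ^ 4).trace := by
    rw [h4]
    refine Finset.sum_congr rfl fun a _ ↦ ?_
    rw [Finset.sum_comm]
    simp_rw [fun b c ↦ hS.apply b c]
  calc _ = ∑ a, ∑ b, ∑ c, ∑ d, (S a b ^ 2 * S c d ^ 2 + S a c ^ 2 * S b d ^ 2
        + S a d ^ 2 * S b c ^ 2 + 2 * (S a b * S b c * S c d * S a d)
        + 2 * (S a b * S b d * S c d * S a c) + 2 * (S a c * S b c * S b d * S a d)) := by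
        refine Finset.sum_congr rfl fun a _ ↦ Finset.sum_congr rfl fun b _ ↦
          Finset.sum_congr rfl fun c _ ↦ Finset.sum_congr rfl fun d _ ↦ ?_
        ring
    _ = _ := by
        simp_rw [Finset.sum_add_distrib, ← Finset.mul_sum] at h2 h2' h2'' h4 h4' h4'' ⊢
        rw [← h2, h2', h2'', ← h4, h4', h4'']
        ring

/-- for independent centered Gaussians with common covariance `Ω`,
`E[(Y₁ᵀY₂)⁴] = 6 tr(Ω⁴) + 3 (tr(Ω²))²`. -/
theorem stmt7 {Ω' : Type*} [MeasurableSpace Ω'] (μ : Measure Ω') [IsProbabilityMeasure μ]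
    {p : ℕ} (Y1 Y2 : Ω' → (Fin p → ℝ))
    (h1meas : Measurable Y1) (h2meas : Measurable Y2)
    (hindep : IndepFun Y1 Y2 μ)
    (h1gauss : IsCenteredGaussianVec (μ.map Y1))
    (h2gauss : IsCenteredGaussianVec (μ.map Y2))
    (Ω : Matrix (Fin p) (Fin p) ℝ)
    (h1cov : ∀ a b, ∫ ω, Y1 ω a * Y1 ω b ∂μ = Ω a b)
    (h2cov : ∀ a b, ∫ ω, Y2 ω a * Y2 ω b ∂μ = Ω a b) :
    ∫ ω, (Y1 ω ⬝ᵥ Y2 ω) ^ 4 ∂μ = 6 * (Ω ^ 4).trace + 3 * ((Ω ^ 2).trace) ^ 2 := by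
  have moment {Y : Ω' → Fin p → ℝ} (hY : Measurable Y) (hg : IsCenteredGaussianVec (μ.map Y))
      (hc : ∀ a b, ∫ ω, Y ω a * Y ω b ∂μ = Ω a b) (a b c d : Fin p) :
      Integrable (fun ω ↦ Y ω a * Y ω b * (Y ω c * Y ω d)) μ ∧
      ∫ ω, Y ω a * Y ω b * (Y ω c * Y ω d) ∂μ = Ω a b * Ω c d + Ω a c * Ω b d + Ω a d * Ω b c := by
    refine ⟨(hg.integrable_eval_mul_four a b c d).comp_measurable hY, ?_⟩
    rw [← hg.integral_eval_mul_four (S := Ω) (fun a b ↦ ?_) a b c d]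
    · rw [integral_map hY.aemeasurable (by fun_prop)]
    · rw [integral_map hY.aemeasurable (by fun_prop), hc]
  have indep (a b c d : Fin p) : IndepFun (fun ω ↦ Y1 ω a * Y1 ω b * (Y1 ω c * Y1 ω d))
      (fun ω ↦ Y2 ω a * Y2 ω b * (Y2 ω c * Y2 ω d)) μ :=
    hindep.comp (φ := fun x : Fin p → ℝ ↦ x a * x b * (x c * x d))
      (ψ := fun x : Fin p → ℝ ↦ x a * x b * (x c * x d)) (by fun_prop) (by fun_prop)
  have hi (a b c d : Fin p) : Integrable (fun ω ↦ Y1 ω a * Y1 ω b * (Y1 ω c * Y1 ω d) *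
      (Y2 ω a * Y2 ω b * (Y2 ω c * Y2 ω d))) μ :=
    (indep a b c d).integrable_mul (moment h1meas h1gauss h1cov a b c d).1
      (moment h2meas h2gauss h2cov a b c d).1
  have hsymm : Ω.IsSymm := .ext fun a b ↦ by simp_rw [← h1cov, mul_comm]
  simp_rw [dotProduct_pow_four]
  rw [← sum_isserlis_sq hsymm, integral_finsetSum _ fun a _ ↦ by fun_prop]
  refine Finset.sum_congr rfl fun a _ ↦ ?_
  rw [integral_finsetSum _ fun b _ ↦ by fun_prop]
  refine Finset.sum_congr rfl fun b _ ↦ ?_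
  rw [integral_finsetSum _ fun c _ ↦ by fun_prop]
  refine Finset.sum_congr rfl fun c _ ↦ ?_
  rw [integral_finsetSum _ fun d _ ↦ by fun_prop]
  refine Finset.sum_congr rfl fun d _ ↦ ?_
  rw [(indep a b c d).integral_fun_mul_eq_mul_integral
      (moment h1meas h1gauss h1cov a b c d).1.aestronglyMeasurable
      (moment h2meas h2gauss h2cov a b c d).1.aestronglyMeasurable,
    (moment h1meas h1gauss h1cov a b c d).2, (moment h2meas h2gauss h2cov a b c d).2, sq]
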